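/- arXiv:1807.08773 — 2 statements merged into one kernel-verified Lean document; each statement's English description precedes it below -/
import Mathlib

section
/- Let ρ and ρ' be density matrices of the same finite dimension n with different spectra, and suppose S(ρ') > S(ρ) and rank(ρ') ≥ rank(ρ). Then there exists a finite dimension m, a quasi-classical density matrix σ of dimension m (diagonal in a fixed orthonormal basis {|j⟩}), and a unitary U on the n·m-dimensional joint space such that tr₂[U(ρ ⊗ σ)U†] = ρ' and D[tr₁[U(ρ ⊗ σ)U†]] = σ, where D is the dephasing channel in the basis {|j⟩} and tr₁, tr₂ denote the partial traces over the first and second tensor factor respectively. -/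
open scoped Kronecker ComplexOrder
open Matrix

noncomputable section

/-- `ρ` is a density matrix: positive semidefinite with unit trace. -/
def IsDensityMatrix {ι : Type*} [Fintype ι] (ρ : Matrix ι ι ℂ) : Prop :=
  ρ.PosSemidef ∧ ρ.trace = 1

/-- Partial trace over the second tensor factor. -/
def ptrace2 {ι κ : Type*} [Fintype κ] (M : Matrix (ι × κ) (ι × κ) ℂ) : Matrix ι ι ℂ :=
  Matrix.of fun i j => ∑ k, M (i, k) (j, k)

/-- Partial trace over the first tensor factor. -/
def ptrace1 {ι κ : Type*} [Fintype ι] (M : Matrix (ι × κ) (ι × κ) ℂ) : Matrix κ κ ℂ :=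
  Matrix.of fun i j => ∑ k, M (k, i) (k, j)

/-- Dephasing (decoherence) channel in the fixed (standard) orthonormal basis `{|j⟩}`:
`D[σ] = ∑ j ⟨j|σ|j⟩ |j⟩⟨j|`. -/
def deph {ι : Type*} [DecidableEq ι] (M : Matrix ι ι ℂ) : Matrix ι ι ℂ :=
  Matrix.diagonal fun j => M j j

/-- The eigenvalue list of a matrix (junk value `0` if not Hermitian). -/
def eigs {ι : Type*} [Fintype ι] [DecidableEq ι] (ρ : Matrix ι ι ℂ) : ι → ℝ :=
  if h : ρ.IsHermitian then h.eigenvalues else 0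

/-- The spectrum of a matrix, as a multiset of real eigenvalues (with multiplicity). -/
def spectra {ι : Type*} [Fintype ι] [DecidableEq ι] (ρ : Matrix ι ι ℂ) : Multiset ℝ :=
  Finset.univ.val.map (eigs ρ)

/-- von Neumann entropy `S(ρ) = -tr(ρ log ρ)`, i.e. the Shannon entropy
of the eigenvalue list (natural logarithm). -/
def vN {ι : Type*} [Fintype ι] [DecidableEq ι] (ρ : Matrix ι ι ℂ) : ℝ :=
  ∑ i, Real.negMulLog (eigs ρ i)

/-- Maximally mixed state `𝟙_d = (1/d)·I_d`. -/
def mm (d : ℕ) : Matrix (Fin d) (Fin d) ℂ :=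
  (d : ℂ)⁻¹ • (1 : Matrix (Fin d) (Fin d) ℂ)

open Filter Topology

/-- The product weight of a sequence of independent samples drawn from `p`. -/
def iid {X : Type*} {N : ℕ} (p : X → ℝ) (x : Fin N → X) : ℝ := ∏ j, p (x j)

section Typicality

variable {X : Type*}

lemma iid_cons {N : ℕ} (p : X → ℝ) (a : X) (x : Fin N → X) :
    iid p (Fin.cons a x : Fin (N + 1) → X) = p a * iid p x := by
  simp [iid, Fin.prod_univ_succ]

lemma iid_nonneg {N : ℕ} {p : X → ℝ} (hp : ∀ x, 0 ≤ p x) (x : Fin N → X) : 0 ≤ iid p x :=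
  Finset.prod_nonneg fun _ _ => hp _

lemma iid_eq_exp {N : ℕ} {p : X → ℝ} {x : Fin N → X} (hx : ∀ j, 0 < p (x j)) :
    iid p x = Real.exp (-∑ j, -Real.log (p (x j))) := by
  rw [iid, Finset.sum_neg_distrib, neg_neg, Real.exp_sum]
  exact Finset.prod_congr rfl fun j _ => (Real.exp_log (hx j)).symm

lemma iid_pos_or_eq_zero {N : ℕ} {p : X → ℝ} (hp : ∀ x, 0 ≤ p x) (x : Fin N → X) :
    (∀ j, 0 < p (x j)) ∨ iid p x = 0 := by
  by_cases h : ∀ j, 0 < p (x j)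
  · exact Or.inl h
  · push Not at h
    obtain ⟨j, hj⟩ := h
    exact Or.inr (Finset.prod_eq_zero (Finset.mem_univ j) (le_antisymm hj (hp _)))

variable [Fintype X]

lemma sum_iid (N : ℕ) {p : X → ℝ} (hp : ∑ x, p x = 1) :
    ∑ x : Fin N → X, iid p x = 1 := by
  classical
  simp only [iid]
  rw [← Fintype.piFinset_univ, ← Finset.prod_univ_sum]
  simp [hp]

lemma sum_fin_succ_fun {N : ℕ} (F : (Fin (N + 1) → X) → ℝ) :
    ∑ x, F x = ∑ a, ∑ y : Fin N → X, F (Fin.cons a y) := by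
  rw [← (Fin.consEquiv fun _ => X).sum_comp, Fintype.sum_prod_type]
  rfl

lemma sum_iid_mul_sum (N : ℕ) {p : X → ℝ} (hp : ∑ x, p x = 1) {g : X → ℝ}
    (hg : ∑ x, p x * g x = 0) :
    ∑ x : Fin N → X, iid p x * ∑ j, g (x j) = 0 := by
  induction N with
  | zero => simp
  | succ N ih =>
    rw [sum_fin_succ_fun]
    have : ∀ a : X, ∑ y : Fin N → X, iid p (Fin.cons a y : Fin (N + 1) → X) *
        ∑ j, g ((Fin.cons a y : Fin (N + 1) → X) j) = p a * g a := by
      intro a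
      simp only [iid_cons, Fin.sum_univ_succ, Fin.cons_zero, Fin.cons_succ]
      have h : ∀ y : Fin N → X, p a * iid p y * (g a + ∑ j, g (y j)) =
          p a * g a * iid p y + p a * (iid p y * ∑ j, g (y j)) := fun y => by ring
      simp only [h, Finset.sum_add_distrib, ← Finset.mul_sum, ih, sum_iid N hp]
      ring
    simp only [this, hg]

lemma sum_iid_mul_sum_sq (N : ℕ) {p : X → ℝ} (hp : ∑ x, p x = 1) {g : X → ℝ}
    (hg : ∑ x, p x * g x = 0) :
    ∑ x : Fin N → X, iid p x * (∑ j, g (x j)) ^ 2 = N * ∑ x, p x * g x ^ 2 := by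
  induction N with
  | zero => simp
  | succ N ih =>
    rw [sum_fin_succ_fun]
    have : ∀ a : X, ∑ y : Fin N → X, iid p (Fin.cons a y : Fin (N + 1) → X) *
        (∑ j, g ((Fin.cons a y : Fin (N + 1) → X) j)) ^ 2 =
        p a * g a ^ 2 + p a * (N * ∑ x, p x * g x ^ 2) := by
      intro a
      simp only [iid_cons, Fin.sum_univ_succ, Fin.cons_zero, Fin.cons_succ]
      have h : ∀ y : Fin N → X, p a * iid p y * (g a + ∑ j, g (y j)) ^ 2 =
          p a * g a ^ 2 * iid p y + 2 * p a * g a * (iid p y * ∑ j, g (y j)) +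
            p a * (iid p y * (∑ j, g (y j)) ^ 2) := fun y => by ring
      simp only [h, Finset.sum_add_distrib, ← Finset.mul_sum, ih, sum_iid N hp,
        sum_iid_mul_sum N hp hg]
      ring
    simp only [this, Finset.sum_add_distrib, ← Finset.sum_mul, hp]
    push_cast
    ring

open Classical in
lemma eventually_deviation_le {p : X → ℝ} (hp0 : ∀ x, 0 ≤ p x) (hp : ∑ x, p x = 1)
    (f : X → ℝ) {δ ε : ℝ} (hδ : 0 < δ) (hε : 0 < ε) :
    ∀ᶠ N : ℕ in atTop,
      ∑ x : Fin N → X with N * δ < |∑ j, f (x j) - N * ∑ a, p a * f a|, iid p x ≤ ε := by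
  set μ := ∑ a, p a * f a with hμ
  set V := ∑ a, p a * (f a - μ) ^ 2 with hV
  have hg : ∑ a, p a * (f a - μ) = 0 := by
    simp only [mul_sub, Finset.sum_sub_distrib, ← Finset.sum_mul, hp, ← hμ]
    ring
  have hlim : Tendsto (fun N : ℕ => V / δ ^ 2 / (N : ℝ)) atTop (𝓝 0) :=
    tendsto_const_div_atTop_nhds_zero_nat _
  filter_upwards [hlim.eventually (gt_mem_nhds hε), eventually_gt_atTop 0] with N hN hN0
  have hN0' : (0 : ℝ) < N := by exact_mod_cast hN0
  refine le_trans ?_ hN.le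
  have key : ∑ x : Fin N → X with N * δ < |∑ j, f (x j) - N * μ|, (N * δ) ^ 2 * iid p x ≤
      N * V := by
    rw [← sum_iid_mul_sum_sq N hp hg]
    refine (Finset.sum_le_sum fun x hx => ?_).trans
      (Finset.sum_le_univ_sum_of_nonneg fun x => mul_nonneg (iid_nonneg hp0 x) (sq_nonneg _))
    have hx' := (Finset.mem_filter.1 hx).2
    have hs : ∑ j, (f (x j) - μ) = ∑ j, f (x j) - N * μ := by simp
    rw [hs, mul_comm]
    refine mul_le_mul_of_nonneg_left ?_ (iid_nonneg hp0 x)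
    rw [← sq_abs (∑ j, f (x j) - N * μ)]
    exact pow_le_pow_left₀ (by positivity) hx'.le 2
  rw [← Finset.mul_sum] at key
  rw [div_div, le_div_iff₀ (by positivity)]
  have : N * ((∑ x : Fin N → X with N * δ < |∑ j, f (x j) - N * μ|, iid p x) * (δ ^ 2 * N)) ≤
      N * V := by
    refine le_trans (le_of_eq ?_) key
    ring
  exact (mul_le_mul_iff_right₀ hN0').1 this

/-- Shannon entropy of a finitely supported weight. -/
def shannon (p : X → ℝ) : ℝ := ∑ x, Real.negMulLog (p x)

lemma shannon_eq (p : X → ℝ) : shannon p = ∑ x, p x * -Real.log (p x) := by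
  simp [shannon, Real.negMulLog]

lemma eventually_exists_concentrated {p : X → ℝ} (hp0 : ∀ x, 0 ≤ p x) (hp : ∑ x, p x = 1)
    {a ε : ℝ} (ha : shannon p < a) (hε : 0 < ε) :
    ∀ᶠ N : ℕ in atTop, ∃ A : Finset (Fin N → X),
      (A.card : ℝ) ≤ Real.exp (N * a) ∧ 1 - ε ≤ ∑ x ∈ A, iid p x := by
  classical
  filter_upwards [eventually_deviation_le hp0 hp (fun x => -Real.log (p x))
    (sub_pos.2 ha) hε] with N hN
  rw [← shannon_eq] at hN
  let A : Finset (Fin N → X) := Finset.univ.filter fun x =>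
    (∀ j, 0 < p (x j)) ∧ ∑ j, -Real.log (p (x j)) ≤ N * a
  refine ⟨A, ?_, ?_⟩
  · have h1 : ∑ x ∈ A, Real.exp (-(N * a)) ≤ 1 := by
      rw [← sum_iid N hp]
      refine (Finset.sum_le_sum fun x hx => ?_).trans
        (Finset.sum_le_univ_sum_of_nonneg fun x => iid_nonneg hp0 x)
      obtain ⟨h, h'⟩ := (Finset.mem_filter.1 hx).2
      rw [iid_eq_exp h]
      exact Real.exp_le_exp.2 (neg_le_neg h')
    rw [Finset.sum_const, nsmul_eq_mul, Real.exp_neg, ← div_eq_mul_inv,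
      div_le_one (Real.exp_pos _)] at h1
    exact h1
  · have h2 : ∑ x ∈ Aᶜ, iid p x ≤ ε := by
      refine le_trans ?_ hN
      rw [← Finset.sum_filter_add_sum_filter_not Aᶜ (fun x => ∀ j, 0 < p (x j))]
      have h3 : ∑ x ∈ Aᶜ with ¬∀ j, 0 < p (x j), iid p x = 0 :=
        Finset.sum_eq_zero fun x hx =>
          (iid_pos_or_eq_zero hp0 x).resolve_left (Finset.mem_filter.1 hx).2
      rw [h3, add_zero]
      refine Finset.sum_le_sum_of_subset_of_nonneg (fun x hx => ?_) fun x _ _ => iid_nonneg hp0 x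
      simp only [A, Finset.mem_filter, Finset.mem_compl, Finset.mem_univ, true_and, not_and,
        not_le] at hx ⊢
      have := hx.1 hx.2
      exact lt_of_lt_of_le (by linarith) (le_abs_self _)
    have h4 := Finset.sum_add_sum_compl A fun x => iid p x
    rw [sum_iid N hp] at h4
    linarith

/-- The number of occurrences of `z` in the sequence `x`. -/
def occ [DecidableEq X] {N : ℕ} (z : X) (x : Fin N → X) : ℝ := ∑ j, if x j = z then 1 else 0

omit [Fintype X] in
lemma sum_biUnion_le_sum_sum {ι : Type*} [DecidableEq X] {f : X → ℝ} (hf : ∀ x, 0 ≤ f x)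
    (s : Finset ι) (t : ι → Finset X) :
    ∑ x ∈ s.biUnion t, f x ≤ ∑ i ∈ s, ∑ x ∈ t i, f x := by
  classical
  induction s using Finset.induction_on with
  | empty => simp
  | insert i s hi ih =>
    rw [Finset.biUnion_insert, Finset.sum_insert hi]
    refine le_trans ?_ (add_le_add_right ih _)
    rw [← Finset.sum_union_inter]
    exact le_add_of_nonneg_right (Finset.sum_nonneg fun x _ => hf x)

lemma eventually_exists_typical [DecidableEq X] {w : X → ℝ} (hw0 : ∀ x, 0 ≤ w x)
    (hw : ∑ x, w x = 1) {b ε : ℝ} (hb : b < shannon w) (hε : 0 < ε) :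
    ∀ᶠ N : ℕ in atTop, ∃ B : Finset (Fin N → X),
      Real.exp (N * b) / 2 ≤ B.card ∧ ∀ x ∈ B, ∀ z, |occ z x - N * w z| ≤ N * ε := by
  classical
  let η : ℝ := (2 * (Fintype.card X + 1 : ℕ))⁻¹
  have hη : 0 < η := by positivity
  have hfreq : ∀ᶠ N : ℕ in atTop, ∀ z : X,
      ∑ x : Fin N → X with N * ε < |occ z x - N * w z|, iid w x ≤ η := by
    refine eventually_all.2 fun z => ?_
    filter_upwards [eventually_deviation_le hw0 hw (fun x => if x = z then 1 else 0) hε hη]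
      with N hN
    simpa [occ] using hN
  filter_upwards [eventually_deviation_le hw0 hw (fun x => -Real.log (w x)) (sub_pos.2 hb) hη,
    hfreq] with N hN hN'
  rw [← shannon_eq] at hN
  let B : Finset (Fin N → X) := Finset.univ.filter fun x =>
    N * b ≤ ∑ j, -Real.log (w (x j)) ∧ ∀ z, |occ z x - N * w z| ≤ N * ε
  refine ⟨B, ?_, fun x hx => (Finset.mem_filter.1 hx).2.2⟩
  have hBc : ∑ x ∈ Bᶜ, iid w x ≤ 1 / 2 := by
    let D : Finset (Fin N → X) := Finset.univ.filter fun x =>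
      N * (shannon w - b) < |∑ j, -Real.log (w (x j)) - N * shannon w|
    let E : X → Finset (Fin N → X) := fun z =>
      Finset.univ.filter fun x => N * ε < |occ z x - N * w z|
    have hsub : Bᶜ ⊆ D ∪ Finset.univ.biUnion E := by
      intro x hx
      by_cases h : N * b ≤ ∑ j, -Real.log (w (x j))
      · have : ∃ z, N * ε < |occ z x - N * w z| := by
          by_contra! h'
          exact (Finset.mem_compl.1 hx) (Finset.mem_filter.2 ⟨Finset.mem_univ _, h, h'⟩)
        obtain ⟨z, hz⟩ := this
        exact Finset.mem_union_right _ (Finset.mem_biUnion.2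
          ⟨z, Finset.mem_univ _, Finset.mem_filter.2 ⟨Finset.mem_univ _, hz⟩⟩)
      · refine Finset.mem_union_left _ (Finset.mem_filter.2 ⟨Finset.mem_univ _, ?_⟩)
        rw [abs_sub_comm]
        exact lt_of_lt_of_le (by linarith) (le_abs_self _)
    have hnn : ∀ x : Fin N → X, 0 ≤ iid w x := iid_nonneg hw0
    calc ∑ x ∈ Bᶜ, iid w x ≤ ∑ x ∈ D ∪ Finset.univ.biUnion E, iid w x :=
          Finset.sum_le_sum_of_subset_of_nonneg hsub fun x _ _ => hnn x
      _ ≤ ∑ x ∈ D, iid w x + ∑ x ∈ Finset.univ.biUnion E, iid w x := by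
          rw [← Finset.sum_union_inter]
          exact le_add_of_nonneg_right (Finset.sum_nonneg fun x _ => hnn x)
      _ ≤ ∑ x ∈ D, iid w x + ∑ z, ∑ x ∈ E z, iid w x := by
          gcongr
          exact sum_biUnion_le_sum_sum hnn Finset.univ E
      _ ≤ η + ∑ _z : X, η := add_le_add hN (Finset.sum_le_sum fun z _ => hN' z)
      _ = 1 / 2 := by
          simp only [Finset.sum_const, Finset.card_univ, nsmul_eq_mul, η]
          push_cast
          field_simp
          ring
  have hB : 1 / 2 ≤ ∑ x ∈ B, iid w x := by
    have h4 := Finset.sum_add_sum_compl B fun x => iid w x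
    rw [sum_iid N hw] at h4
    linarith
  have hle : ∑ x ∈ B, iid w x ≤ ∑ x ∈ B, Real.exp (-(N * b)) := by
    refine Finset.sum_le_sum fun x hx => ?_
    rcases iid_pos_or_eq_zero hw0 x with h | h
    · rw [iid_eq_exp h]
      exact Real.exp_le_exp.2 (neg_le_neg (Finset.mem_filter.1 hx).2.1)
    · rw [h]
      positivity
  rw [Finset.sum_const, nsmul_eq_mul, Real.exp_neg, ← div_eq_mul_inv] at hle
  have := hB.trans hle
  rw [le_div_iff₀ (Real.exp_pos _)] at this
  linarith

lemma exists_perm_mapsTo {α : Type*} [Finite α] {s t : Finset α} (h : s.card ≤ t.card) :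
    ∃ σ : Equiv.Perm α, ∀ x ∈ s, σ x ∈ t := by
  obtain ⟨t', ht', hc⟩ := Finset.exists_subset_card_eq h
  obtain ⟨σ, hσ⟩ := Equiv.Perm.exists_map_finset_eq s t' hc.symm
  refine ⟨σ, fun x hx => ht' ?_⟩
  rw [← hσ]
  exact Finset.mem_map_of_mem _ hx

/-- The mean empirical distribution of `P x` when `x` is an independent sample from `p`. -/
def meanMarginal [DecidableEq X] {N : ℕ} (p : X → ℝ) (P : Equiv.Perm (Fin N → X)) (z : X) : ℝ :=
  ∑ x, iid p x * (occ z (P x) / N)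

lemma eventually_exists_perm_near [DecidableEq X] {p w : X → ℝ} (hp0 : ∀ x, 0 ≤ p x)
    (hp : ∑ x, p x = 1) (hw0 : ∀ x, 0 ≤ w x) (hw : ∑ x, w x = 1)
    (h : shannon p < shannon w) {ε : ℝ} (hε : 0 < ε) :
    ∀ᶠ N : ℕ in atTop, ∃ P : Equiv.Perm (Fin N → X), ∀ z, |meanMarginal p P z - w z| ≤ ε := by
  obtain ⟨a, ha, ha'⟩ := exists_between h
  obtain ⟨b, hb, hb'⟩ := exists_between ha'
  have hε' := half_pos hε
  have hexp : ∀ᶠ N : ℕ in atTop, Real.log 2 / (b - a) ≤ N :=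
    tendsto_natCast_atTop_atTop.eventually_ge_atTop _
  filter_upwards [eventually_exists_concentrated hp0 hp ha hε',
    eventually_exists_typical hw0 hw hb' hε', hexp, eventually_gt_atTop 0]
    with N ⟨A, hA, hA'⟩ ⟨B, hB, hB'⟩ hN hN0
  have hN0' : (0 : ℝ) < N := by exact_mod_cast hN0
  have hcard : A.card ≤ B.card := by
    have h2 : 2 * Real.exp (N * a) ≤ Real.exp (N * b) := by
      rw [div_le_iff₀ (sub_pos.2 hb)] at hN
      have : Real.exp (Real.log 2 + N * a) ≤ Real.exp (N * b) :=
        Real.exp_le_exp.2 (by linarith)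
      rwa [Real.exp_add, Real.exp_log two_pos] at this
    have : (A.card : ℝ) ≤ B.card := by linarith
    exact_mod_cast this
  obtain ⟨P, hP⟩ := exists_perm_mapsTo hcard
  refine ⟨P, fun z => ?_⟩
  have hw1 : w z ≤ 1 := hw ▸ Finset.single_le_sum (fun x _ => hw0 x) (Finset.mem_univ z)
  have heq : meanMarginal p P z - w z = ∑ x, iid p x * (occ z (P x) / N - w z) := by
    simp only [meanMarginal, mul_sub, Finset.sum_sub_distrib, ← Finset.sum_mul, sum_iid N hp,
      one_mul]
  have hone : ∀ x : Fin N → X, |occ z x / N - w z| ≤ 1 := by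
    intro x
    have h0 : 0 ≤ occ z x := Finset.sum_nonneg fun j _ => by split_ifs <;> norm_num
    have h1 : occ z x ≤ N := by
      calc occ z x ≤ ∑ _j : Fin N, (1 : ℝ) :=
            Finset.sum_le_sum fun j _ => by split_ifs <;> norm_num
        _ = N := by simp
    have h2 : occ z x / N ≤ 1 := (div_le_one hN0').2 h1
    have h3 : 0 ≤ occ z x / N := by positivity
    have := hw0 z
    rw [abs_le]
    constructor <;> linarith
  have htyp : ∀ x ∈ A, |occ z (P x) / N - w z| ≤ ε / 2 := by
    intro x hx
    have h1 := hB' _ (hP x hx) z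
    have h2 : occ z (P x) / N - w z = (occ z (P x) - N * w z) / N := by field_simp
    rw [h2, abs_div, abs_of_pos hN0', div_le_iff₀ hN0']
    linarith
  have hsum := Finset.sum_add_sum_compl A fun x => iid p x
  rw [sum_iid N hp] at hsum
  have hA1 : ∑ x ∈ A, iid p x ≤ 1 := by
    have : 0 ≤ ∑ x ∈ Aᶜ, iid p x := Finset.sum_nonneg fun x _ => iid_nonneg hp0 x
    linarith
  rw [heq]
  calc |∑ x, iid p x * (occ z (P x) / N - w z)|
      ≤ ∑ x, iid p x * |occ z (P x) / N - w z| := by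
        refine (Finset.abs_sum_le_sum_abs _ _).trans (le_of_eq ?_)
        exact Finset.sum_congr rfl fun x _ => by rw [abs_mul, abs_of_nonneg (iid_nonneg hp0 x)]
    _ = ∑ x ∈ A, iid p x * |occ z (P x) / N - w z| +
          ∑ x ∈ Aᶜ, iid p x * |occ z (P x) / N - w z| :=
        (Finset.sum_add_sum_compl A _).symm
    _ ≤ ∑ x ∈ A, iid p x * (ε / 2) + ∑ x ∈ Aᶜ, iid p x * 1 := by
        gcongr with x hx x hx
        · exact iid_nonneg hp0 x
        · exact htyp x hx
        · exact iid_nonneg hp0 x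
        · exact hone _
    _ ≤ ε := by
        rw [← Finset.sum_mul, ← Finset.sum_mul]
        nlinarith

end Typicality

section Convexity

lemma exists_weights_of_mem_convexHull_range {ι X : Type*} [Fintype ι] {v : ι → X → ℝ} {q : X → ℝ}
    (h : q ∈ convexHull ℝ (Set.range v)) :
    ∃ r : ι → ℝ, (∀ i, 0 ≤ r i) ∧ ∑ i, r i = 1 ∧ ∀ z, ∑ i, r i * v i z = q z := by
  classical
  rw [convexHull_range_eq_exists_affineCombination] at h
  obtain ⟨s, r, hr0, hr1, hr⟩ := h
  rw [s.affineCombination_eq_linear_combination v r hr1] at hr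
  refine ⟨fun i => if i ∈ s then r i else 0, fun i => ?_, ?_, fun z => ?_⟩
  · dsimp only
    split_ifs with hi
    exacts [hr0 i hi, le_rfl]
  · simpa using hr1
  · rw [← hr]
    simp [Finset.sum_apply]

variable {X : Type*} [Fintype X] [DecidableEq X]

/-- A strictly positive distribution lies in the convex hull of points that are close to its
displacements towards the vertices of the simplex. -/
lemma mem_convexHull_of_near_vertices {q : X → ℝ} {κ η ε : ℝ} (hκ : 0 < κ) (hqκ : ∀ x, κ ≤ q x)
    (hq : ∑ x, q x = 1) (hε : ε * Fintype.card X ≤ η * κ) {v : X → X → ℝ}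
    (hv1 : ∀ y, ∑ z, v y z = 1)
    (hv : ∀ y z, |v y z - ((1 - η) * q z + η * if z = y then 1 else 0)| ≤ ε) :
    q ∈ convexHull ℝ (Set.range v) := by
  by_contra hmem
  obtain ⟨f, u, hfu, huq⟩ := geometric_hahn_banach_closed_point (convex_convexHull ℝ _)
    ((Set.finite_range v).isClosed_convexHull ℝ) hmem
  have hexp : ∀ x : X → ℝ, f x = ∑ z, x z * f (Pi.single z 1) := by
    intro x
    conv_lhs => rw [pi_eq_sum_univ' x, map_sum]
    refine Finset.sum_congr rfl fun z _ => ?_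
    rw [map_smul, smul_eq_mul]
  let h : X → ℝ := fun z => f (Pi.single z 1) - f q
  have hh : ∀ x : X → ℝ, ∑ z, x z = 1 → ∑ z, x z * h z = f x - f q := by
    intro x hx
    simp only [h, mul_sub, Finset.sum_sub_distrib, ← Finset.sum_mul, hx, ← hexp, one_mul]
  have hqh : ∑ z, q z * h z = 0 := by rw [hh q hq, sub_self]
  have hne : Nonempty X := by
    by_contra hX
    rw [not_nonempty_iff] at hX
    simp at hq
  obtain ⟨y, hy⟩ := Finite.exists_max h
  have hq0 : ∀ x, 0 ≤ q x := fun x => hκ.le.trans (hqκ x)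
  have hy0 : 0 ≤ h y := by
    calc 0 = ∑ z, q z * h z := hqh.symm
      _ ≤ ∑ z, q z * h y := Finset.sum_le_sum fun z _ => mul_le_mul_of_nonneg_left (hy z) (hq0 z)
      _ = h y := by rw [← Finset.sum_mul, hq, one_mul]
  have habs : ∀ z, κ * |h z| ≤ h y := by
    intro z
    have h1 : q z * (h y - h z) ≤ ∑ x, q x * (h y - h x) :=
      Finset.single_le_sum (f := fun x => q x * (h y - h x))
        (fun x _ => mul_nonneg (hq0 x) (sub_nonneg.2 (hy x))) (Finset.mem_univ z)
    have h2 : ∑ x, q x * (h y - h x) = h y := by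
      simp only [mul_sub, Finset.sum_sub_distrib, ← Finset.sum_mul, hq, hqh]
      ring
    have h3 : κ * (h y - h z) ≤ h y :=
      (mul_le_mul_of_nonneg_right (hqκ z) (sub_nonneg.2 (hy z))).trans (h1.trans h2.le)
    have hz1 : q z ≤ 1 := hq ▸ Finset.single_le_sum (fun x _ => hq0 x) (Finset.mem_univ z)
    have hκ1 : κ ≤ 1 := (hqκ z).trans hz1
    rcases abs_cases (h z) with ⟨h4, h5⟩ | ⟨h4, h5⟩
    · rw [h4]
      nlinarith [hy z]
    · rw [h4]
      nlinarith
  have hlt : ∑ z, v y z * h z < 0 := by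
    rw [hh _ (hv1 y)]
    have := hfu (v y) (subset_convexHull ℝ _ ⟨y, rfl⟩)
    linarith
  have hw : ∑ z, ((1 - η) * q z + η * if z = y then 1 else 0) * h z = η * h y := by
    have : ∀ z, ((1 - η) * q z + η * if z = y then 1 else 0) * h z =
        (1 - η) * (q z * h z) + η * ((if z = y then 1 else 0) * h z) := fun z => by ring
    simp only [this, Finset.sum_add_distrib, ← Finset.mul_sum, hqh]
    simp
  have hdiff : ∑ z, κ * ((1 - η) * q z + η * (if z = y then 1 else 0) - v y z) * h z ≤
      ε * Fintype.card X * h y := by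
    calc ∑ z, κ * ((1 - η) * q z + η * (if z = y then 1 else 0) - v y z) * h z
        ≤ ∑ _z : X, ε * h y := by
          refine Finset.sum_le_sum fun z _ => ?_
          have h1 := hv y z
          rw [abs_sub_comm] at h1
          calc κ * ((1 - η) * q z + η * (if z = y then 1 else 0) - v y z) * h z
              = κ * (((1 - η) * q z + η * (if z = y then 1 else 0) - v y z) * h z) := by ring
            _ ≤ κ * (|(1 - η) * q z + η * (if z = y then 1 else 0) - v y z| * |h z|) := by
                rw [← abs_mul]
                exact mul_le_mul_of_nonneg_left (le_abs_self _) hκ.le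
            _ = |(1 - η) * q z + η * (if z = y then 1 else 0) - v y z| * (κ * |h z|) := by ring
            _ ≤ ε * h y := mul_le_mul h1 (habs z) (by positivity) ((abs_nonneg _).trans h1)
      _ = ε * Fintype.card X * h y := by
          rw [Finset.sum_const, Finset.card_univ, nsmul_eq_mul]
          ring
  have hsplit : ∑ z, κ * ((1 - η) * q z + η * (if z = y then 1 else 0) - v y z) * h z =
      κ * (η * h y) - κ * ∑ z, v y z * h z := by
    rw [← hw, Finset.mul_sum, Finset.mul_sum, ← Finset.sum_sub_distrib]
    exact Finset.sum_congr rfl fun z _ => by ring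
  have : ε * Fintype.card X * h y ≤ η * κ * h y := mul_le_mul_of_nonneg_right hε hy0
  nlinarith [mul_neg_of_pos_of_neg hκ hlt]

lemma sum_meanMarginal {N : ℕ} (hN : 0 < N) {p : X → ℝ} (hp : ∑ x, p x = 1)
    (P : Equiv.Perm (Fin N → X)) : ∑ z, meanMarginal p P z = 1 := by
  simp only [meanMarginal]
  rw [Finset.sum_comm]
  have : ∀ x : Fin N → X, ∑ z, occ z x = N := by
    intro x
    simp only [occ]
    rw [Finset.sum_comm]
    simp
  have hN' : (N : ℝ) ≠ 0 := by exact_mod_cast hN.ne'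
  simp only [← Finset.mul_sum, ← Finset.sum_div, this, div_self hN', mul_one, sum_iid N hp]

lemma exists_mixture_meanMarginal_eq {p q : X → ℝ} (hp0 : ∀ x, 0 ≤ p x) (hp : ∑ x, p x = 1)
    (hq0 : ∀ x, 0 < q x) (hq : ∑ x, q x = 1) (h : shannon p < shannon q) :
    ∃ (M : ℕ) (P : X → Equiv.Perm (Fin (M + 1) → X)) (r : X → ℝ),
      (∀ y, 0 ≤ r y) ∧ ∑ y, r y = 1 ∧ ∀ z, ∑ y, r y * meanMarginal p (P y) z = q z := by
  have hne : Nonempty X := by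
    by_contra hX
    rw [not_nonempty_iff] at hX
    simp at hq
  obtain ⟨x₀, hx₀⟩ := Finite.exists_min q
  let w : ℝ → X → X → ℝ := fun η y z => (1 - η) * q z + η * (if z = y then 1 else 0)
  have hcont : ∀ y, ∀ᶠ η in 𝓝[>] (0 : ℝ), shannon p < shannon (w η y) := by
    intro y
    have hc : Continuous fun η : ℝ => shannon (w η y) :=
      continuous_finsetSum _ fun z _ => Real.continuous_negMulLog.comp (by fun_prop)
    have h0 : shannon p < shannon (w 0 y) := by simpa [w] using h
    exact nhdsWithin_le_nhds (hc.continuousAt.eventually (lt_mem_nhds h0))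
  obtain ⟨η, hη, hη0, hη1⟩ := ((eventually_all.2 hcont).and
    (Ioo_mem_nhdsGT (zero_lt_one (α := ℝ)))).exists
  have hw0 : ∀ y z, 0 ≤ w η y z := fun y z => by
    have h1 : (0 : ℝ) ≤ if z = y then 1 else 0 := by
      split_ifs <;> norm_num
    exact add_nonneg (mul_nonneg (by linarith) (hq0 z).le) (mul_nonneg hη0.le h1)
  have hw1 : ∀ y, ∑ z, w η y z = 1 := fun y => by
    simp [w, Finset.sum_add_distrib, ← Finset.mul_sum, hq]
  have hcard : (0 : ℝ) < Fintype.card X := by exact_mod_cast Fintype.card_pos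
  let ε : ℝ := η * q x₀ / Fintype.card X
  have hε : 0 < ε := by have := hq0 x₀; positivity
  have hev := (eventually_all.2 fun y =>
    eventually_exists_perm_near hp0 hp (hw0 y) (hw1 y) (hη y) hε).and (eventually_gt_atTop 0)
  obtain ⟨N, hN, hN0⟩ := hev.exists
  obtain ⟨M, rfl⟩ := Nat.exists_eq_succ_of_ne_zero hN0.ne'
  choose P hP using hN
  obtain ⟨r, hr0, hr1, hr⟩ := exists_weights_of_mem_convexHull_range
    (mem_convexHull_of_near_vertices (hq0 x₀) hx₀ hq
      (by simp only [ε]; rw [div_mul_cancel₀ _ hcard.ne'])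
      (v := fun y => meanMarginal p (P y)) (fun y => sum_meanMarginal hN0 hp (P y)) hP)
  exact ⟨M, P, r, hr0, hr1, hr⟩

end Convexity

section Catalysis

/-- The distribution `p` can be turned into `q` by a permutation of the joint outcomes with a
catalyst whose marginal distribution is preserved. -/
def CatalyticallyConvertible {X : Type*} [Fintype X] (p q : X → ℝ) : Prop :=
  ∃ (m : ℕ) (c : Fin m → ℝ), (∀ j, 0 ≤ c j) ∧ ∑ j, c j = 1 ∧
    ∃ π : Equiv.Perm (X × Fin m),
      (∀ a, ∑ j, p (π (a, j)).1 * c (π (a, j)).2 = q a) ∧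
      ∀ j, ∑ a, p (π (a, j)).1 * c (π (a, j)).2 = c j

lemma CatalyticallyConvertible.of_fintype {X C : Type*} [Fintype X] [Fintype C] {p q : X → ℝ}
    {c : C → ℝ} (hc0 : ∀ j, 0 ≤ c j) (hc1 : ∑ j, c j = 1) (π : Equiv.Perm (X × C))
    (hq : ∀ a, ∑ j, p (π (a, j)).1 * c (π (a, j)).2 = q a)
    (hc : ∀ j, ∑ a, p (π (a, j)).1 * c (π (a, j)).2 = c j) :
    CatalyticallyConvertible p q := by
  let e := (Fintype.equivFin C).symm
  let E : X × Fin (Fintype.card C) ≃ X × C := (Equiv.refl X).prodCongr e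
  refine ⟨_, c ∘ e, fun j => hc0 _, ?_, (E.trans π).trans E.symm, fun a => ?_, fun j => ?_⟩
  · rw [← hc1, ← e.sum_comp]
    rfl
  · rw [← hq a, ← e.sum_comp]
    simp [E]
  · rw [Function.comp_apply, ← hc (e j)]
    simp [E]

variable {X R : Type*} [Fintype X] [DecidableEq X] {M : ℕ}

/-- The transition weight at site `j` of the channel replacing the first `k` entries of a sequence
by independent samples from `p`. -/
def refresh (p : X → ℝ) (k j : ℕ) (a b : X) : ℝ :=
  if j < k then p b else if a = b then 1 else 0

lemma sum_refresh {p : X → ℝ} (hp : ∑ x, p x = 1) (k j : ℕ) (a : X) :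
    ∑ b, refresh p k j a b = 1 := by
  unfold refresh
  split_ifs <;> simp [hp]

omit [Fintype X] in
lemma refresh_nonneg {p : X → ℝ} (hp : ∀ x, 0 ≤ p x) (k j : ℕ) (a b : X) :
    0 ≤ refresh p k j a b := by
  unfold refresh
  split_ifs <;> simp [hp]

/-- The joint weight `T` of a sequence and a label after the first `k` entries of the sequence have
been replaced by independent samples from `p`. -/
def refreshed (p : X → ℝ) (T : (Fin (M + 1) → X) → R → ℝ) (k : ℕ)
    (z : Fin (M + 1) → X) (r : R) : ℝ :=
  ∑ x, T x r * ∏ j : Fin (M + 1), refresh p k j (x j) (z j)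

/-- The marginal of `refreshed p T k` on the sites different from `k` and the label. -/
def refreshedRest (p : X → ℝ) (T : (Fin (M + 1) → X) → R → ℝ) (k : Fin (M + 1))
    (y : Fin M → X) (r : R) : ℝ :=
  ∑ x, T x r * ∏ i : Fin M, refresh p k (k.succAbove i) (x (k.succAbove i)) (y i)

lemma refreshed_zero (p : X → ℝ) (T : (Fin (M + 1) → X) → R → ℝ) (z : Fin (M + 1) → X) (r : R) :
    refreshed p T 0 z r = T z r := by
  unfold refreshed
  rw [Finset.sum_eq_single z]
  · simp [refresh]
  · intro x _ hx
    obtain ⟨j, hj⟩ := Function.ne_iff.1 hx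
    rw [Finset.prod_eq_zero (Finset.mem_univ j) (by simp [refresh, hj]), mul_zero]
  · simp

lemma refreshed_last (p : X → ℝ) (T : (Fin (M + 1) → X) → R → ℝ) (z : Fin (M + 1) → X) (r : R) :
    refreshed p T (M + 1) z r = (∑ x, T x r) * iid p z := by
  simp [refreshed, refresh, iid, Finset.sum_mul, Fin.is_le]

lemma sum_refreshed_insertNth {p : X → ℝ} (hp : ∑ x, p x = 1) (T : (Fin (M + 1) → X) → R → ℝ)
    (k : Fin (M + 1)) (y : Fin M → X) (r : R) :
    ∑ a, refreshed p T k (k.insertNth a y : Fin (M + 1) → X) r = refreshedRest p T k y r := by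
  simp only [refreshed, refreshedRest]
  rw [Finset.sum_comm]
  refine Finset.sum_congr rfl fun x _ => ?_
  simp only [Fin.prod_univ_succAbove _ k, Fin.insertNth_apply_same, Fin.insertNth_apply_succAbove]
  rw [← Finset.mul_sum, ← Finset.sum_mul, sum_refresh hp, one_mul]

lemma refreshed_succ_insertNth (p : X → ℝ) (T : (Fin (M + 1) → X) → R → ℝ)
    (k : Fin (M + 1)) (a : X) (y : Fin M → X) (r : R) :
    refreshed p T (k + 1 : ℕ) (k.insertNth a y : Fin (M + 1) → X) r =
      p a * refreshedRest p T k y r := by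
  simp only [refreshed, refreshedRest]
  rw [Finset.mul_sum]
  refine Finset.sum_congr rfl fun x _ => ?_
  simp only [Fin.prod_univ_succAbove _ k, Fin.insertNth_apply_same, Fin.insertNth_apply_succAbove]
  have h1 : refresh p (k + 1 : ℕ) k (x k) a = p a := by simp [refresh]
  have h2 : ∀ i : Fin M, refresh p (k + 1 : ℕ) (k.succAbove i) (x (k.succAbove i)) (y i) =
      refresh p k (k.succAbove i) (x (k.succAbove i)) (y i) := by
    intro i
    have h3 : ((k.succAbove i : Fin (M + 1)) : ℕ) ≠ k := fun h =>
      Fin.succAbove_ne k i (Fin.ext h)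
    have h4 : ((k.succAbove i : Fin (M + 1)) : ℕ) < k + 1 ↔ (k.succAbove i : ℕ) < k := by omega
    simp only [refresh, h4]
  rw [h1, Finset.prod_congr rfl fun i _ => h2 i]
  ring

lemma sum_refreshedRest [Fintype R] {p : X → ℝ} (hp : ∑ x, p x = 1)
    (T : (Fin (M + 1) → X) → R → ℝ) (k : Fin (M + 1)) :
    ∑ y, ∑ r, refreshedRest p T k y r = ∑ r, ∑ x, T x r := by
  simp only [refreshedRest]
  rw [Finset.sum_comm]
  refine Finset.sum_congr rfl fun r _ => ?_
  rw [Finset.sum_comm]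
  refine Finset.sum_congr rfl fun x _ => ?_
  rw [← Finset.mul_sum, ← Fintype.piFinset_univ, ← Finset.prod_univ_sum]
  simp [sum_refresh hp]

lemma sum_refreshed_insertNth_rest [Fintype R] {p : X → ℝ} (hp : ∑ x, p x = 1)
    (T : (Fin (M + 1) → X) → R → ℝ) (k : Fin (M + 1)) (a : X) :
    ∑ y, ∑ r, refreshed p T k (k.insertNth a y : Fin (M + 1) → X) r =
      ∑ r, ∑ x, T x r * if x k = a then 1 else 0 := by
  simp only [refreshed]
  rw [Finset.sum_comm]
  refine Finset.sum_congr rfl fun r _ => ?_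
  rw [Finset.sum_comm]
  refine Finset.sum_congr rfl fun x _ => ?_
  simp only [Fin.prod_univ_succAbove _ k, Fin.insertNth_apply_same, Fin.insertNth_apply_succAbove]
  rw [← Finset.mul_sum, ← Finset.mul_sum, ← Fintype.piFinset_univ, ← Finset.prod_univ_sum]
  simp only [sum_refresh hp, Finset.prod_const_one, mul_one]
  simp [refresh]

/-- Insertion of a system value at the site singled out by the catalyst. -/
def insertEquiv (X R : Type*) (M : ℕ) :
    X × (Fin (M + 1) × (Fin M → X) × R) ≃ Fin (M + 1) × (Fin (M + 1) → X) × R where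
  toFun t := (t.2.1, t.2.1.insertNth t.1 t.2.2.1, t.2.2.2)
  invFun s := (s.2.1 s.1, s.1, s.1.removeNth s.2.1, s.2.2)
  left_inv t := by simp
  right_inv s := by simp

/-- Decrement of the site index, where the sequence is permuted according to its label when the
index wraps around. -/
def stepEquiv (Q : R → Equiv.Perm (Fin (M + 1) → X)) :
    Equiv.Perm (Fin (M + 1) × (Fin (M + 1) → X) × R) where
  toFun s := (s.1 - 1, if s.1 = 0 then Q s.2.2 s.2.1 else s.2.1, s.2.2)
  invFun s := (s.1 + 1, if s.1 + 1 = 0 then (Q s.2.2).symm s.2.1 else s.2.1, s.2.2)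
  left_inv := by
    rintro ⟨k, z, r⟩
    by_cases h : k = 0 <;> simp [h]
  right_inv := by
    rintro ⟨k, z, r⟩
    by_cases h : k + 1 = 0
    · simp [eq_neg_of_add_eq_zero_left h]
    · simp [h]

theorem CatalyticallyConvertible.of_mixture [Fintype R] {p q : X → ℝ} (hp0 : ∀ x, 0 ≤ p x)
    (hp : ∑ x, p x = 1) (P : R → Equiv.Perm (Fin (M + 1) → X)) {w : R → ℝ} (hw0 : ∀ r, 0 ≤ w r)
    (hw : ∑ r, w r = 1) (hq : ∀ z, ∑ r, w r * meanMarginal p (P r) z = q z) :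
    CatalyticallyConvertible p q := by
  let T : (Fin (M + 1) → X) → R → ℝ := fun x r => w r * iid p ((P r).symm x)
  have hT0 : ∀ x r, 0 ≤ T x r := fun x r => mul_nonneg (hw0 r) (iid_nonneg hp0 _)
  have hTr : ∀ r, ∑ x, T x r = w r := fun r => by
    simp only [T]
    rw [← Finset.mul_sum, (P r).symm.sum_comp (iid p), sum_iid _ hp, mul_one]
  have hM : ((M + 1 : ℕ) : ℝ) ≠ 0 := by positivity
  let c : Fin (M + 1) × (Fin M → X) × R → ℝ := fun s =>
    refreshedRest p T s.1 s.2.1 s.2.2 / (M + 1 : ℕ)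
  let π : Equiv.Perm (X × (Fin (M + 1) × (Fin M → X) × R)) :=
    ((insertEquiv X R M).trans (stepEquiv fun r => (P r).symm)).trans (insertEquiv X R M).symm
  have hweight : ∀ t, p t.1 * c t.2 = refreshed p T (t.2.1 + 1 : ℕ)
      ((insertEquiv X R M) t).2.1 t.2.2.2 / (M + 1 : ℕ) := by
    rintro ⟨a, k, y, r⟩
    simp only [c, insertEquiv, Equiv.coe_fn_mk]
    rw [refreshed_succ_insertNth, mul_div_assoc]
  have hπ : ∀ a k y r, p (π (a, k, y, r)).1 * c (π (a, k, y, r)).2 =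
      refreshed p T k (k.insertNth a y : Fin (M + 1) → X) r / (M + 1 : ℕ) := by
    intro a k y r
    rw [hweight]
    simp only [π, Equiv.trans_apply, Equiv.apply_symm_apply]
    by_cases hk : k = 0
    · subst hk
      simp only [insertEquiv, stepEquiv, Equiv.coe_fn_mk, Equiv.coe_fn_symm_mk, if_true]
      have : (((0 : Fin (M + 1)) - 1 : Fin (M + 1)) : ℕ) + 1 = M + 1 := by
        simp [Fin.coe_neg_one]
      rw [this, refreshed_last, hTr, Fin.val_zero, refreshed_zero]
    · simp only [insertEquiv, stepEquiv, Equiv.coe_fn_mk, Equiv.coe_fn_symm_mk, if_neg hk]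
      have : ((k - 1 : Fin (M + 1)) : ℕ) + 1 = k := by
        rw [Fin.val_sub_one_of_ne_zero hk]
        have : (k : ℕ) ≠ 0 := fun h => hk (Fin.ext h)
        omega
      rw [this]
  refine CatalyticallyConvertible.of_fintype (c := c) (fun s => ?_) ?_ π (fun a => ?_) ?_
  · exact div_nonneg (Finset.sum_nonneg fun x _ => mul_nonneg (hT0 _ _)
      (Finset.prod_nonneg fun i _ => refresh_nonneg hp0 _ _ _ _)) (Nat.cast_nonneg _)
  · simp only [c, Fintype.sum_prod_type, ← Finset.sum_div, sum_refreshedRest hp, hTr, hw]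
    simp only [Finset.sum_const, Finset.card_univ, Fintype.card_fin, nsmul_eq_mul, mul_one]
    exact div_self hM
  · simp only [Fintype.sum_prod_type, hπ, ← Finset.sum_div, sum_refreshed_insertNth_rest hp]
    rw [← hq a, Finset.sum_comm, Finset.sum_div]
    refine Finset.sum_congr rfl fun r _ => ?_
    rw [Finset.sum_comm, meanMarginal, ← Equiv.sum_comp (P r), Finset.sum_div, Finset.mul_sum]
    refine Finset.sum_congr rfl fun x _ => ?_
    simp only [T, Equiv.symm_apply_apply, ← Finset.mul_sum, occ]
    ring
  · rintro ⟨k, y, r⟩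
    simp only [hπ, ← Finset.sum_div, sum_refreshed_insertNth hp, c]

end Catalysis

section Supports

variable {X : Type*} [Fintype X]

lemma sum_subtype_eq_sum {P : X → Prop} [DecidablePred P] {f : X → ℝ} (hf : ∀ x, ¬P x → f x = 0) :
    ∑ x : Subtype P, f x = ∑ x, f x := by
  rw [← Fintype.sum_subtype_add_sum_subtype P f,
    Finset.sum_eq_zero (s := Finset.univ) (f := fun x : { x // ¬P x } => f x) fun x _ => hf x x.2,
    add_zero]

lemma CatalyticallyConvertible.of_subtype {P : X → Prop} [DecidablePred P] {p q : X → ℝ}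
    (hp : ∀ x, ¬P x → p x = 0) (hq : ∀ x, ¬P x → q x = 0)
    (h : CatalyticallyConvertible (fun x : Subtype P => p x) fun x : Subtype P => q x) :
    CatalyticallyConvertible p q := by
  obtain ⟨m, c, hc0, hc1, π, hπq, hπc⟩ := h
  let f : Subtype P × Fin m ≃ { t : X × Fin m // P t.1 } :=
    { toFun := fun t => ⟨(t.1, t.2), t.1.2⟩
      invFun := fun t => (⟨t.1.1, t.2⟩, t.1.2)
      left_inv := fun _ => rfl
      right_inv := fun _ => rfl }
  let π' := π.extendDomain f
  have hin : ∀ (a : Subtype P) j, p (π' (a, j)).1 * c (π' (a, j)).2 =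
      p (π (a, j)).1 * c (π (a, j)).2 := by
    intro a j
    have : π' (a, j) = f (π (a, j)) := Equiv.Perm.extendDomain_apply_image π f (a, j)
    rw [this]
    rfl
  have hout : ∀ a j, ¬P a → p (π' (a, j)).1 * c (π' (a, j)).2 = 0 := by
    intro a j ha
    have : π' (a, j) = (a, j) := Equiv.Perm.extendDomain_apply_not_subtype π f ha
    rw [this, hp a ha, zero_mul]
  refine ⟨m, c, hc0, hc1, π', fun a => ?_, fun j => ?_⟩
  · by_cases ha : P a
    · refine Eq.trans ?_ (hπq ⟨a, ha⟩)
      exact Finset.sum_congr rfl fun j _ => hin ⟨a, ha⟩ j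
    · rw [hq a ha]
      exact Finset.sum_eq_zero fun j _ => hout a j ha
  · rw [← hπc j, ← sum_subtype_eq_sum fun a ha => hout a j ha]
    exact Finset.sum_congr rfl fun a _ => hin a j

lemma CatalyticallyConvertible.of_comp_perm {p q : X → ℝ} (σ : Equiv.Perm X)
    (h : CatalyticallyConvertible (p ∘ σ) q) : CatalyticallyConvertible p q := by
  obtain ⟨m, c, hc0, hc1, π, hπq, hπc⟩ := h
  exact ⟨m, c, hc0, hc1, π.trans (σ.prodCongr (Equiv.refl _)), hπq, hπc⟩

theorem CatalyticallyConvertible.of_shannon_lt {p q : X → ℝ} (hp0 : ∀ x, 0 ≤ p x)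
    (hp : ∑ x, p x = 1) (hq0 : ∀ x, 0 ≤ q x) (hq : ∑ x, q x = 1) (h : shannon p < shannon q)
    (hsupp : Fintype.card { x // p x ≠ 0 } ≤ Fintype.card { x // q x ≠ 0 }) :
    CatalyticallyConvertible p q := by
  classical
  rw [Fintype.card_subtype, Fintype.card_subtype] at hsupp
  obtain ⟨σ, hσ⟩ := exists_perm_mapsTo hsupp
  refine CatalyticallyConvertible.of_comp_perm σ.symm ?_
  have hpz : ∀ x, ¬q x ≠ 0 → (p ∘ σ.symm) x = 0 := by
    intro x hx
    by_contra hpx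
    have := hσ (σ.symm x) (Finset.mem_filter.2 ⟨Finset.mem_univ _, hpx⟩)
    rw [Equiv.apply_symm_apply] at this
    exact hx (Finset.mem_filter.1 this).2
  have hqz : ∀ x, ¬q x ≠ 0 → q x = 0 := fun x hx => not_not.1 hx
  refine CatalyticallyConvertible.of_subtype hpz hqz ?_
  have hp1 : ∑ x : { x // q x ≠ 0 }, (p ∘ σ.symm) x = 1 := by
    rw [sum_subtype_eq_sum hpz, ← hp]
    exact Equiv.sum_comp σ.symm p
  have hq1 : ∑ x : { x // q x ≠ 0 }, q x = 1 := by rw [sum_subtype_eq_sum hqz, hq]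
  have hS : shannon (fun x : { x // q x ≠ 0 } => (p ∘ σ.symm) x) <
      shannon fun x : { x // q x ≠ 0 } => q x := by
    unfold shannon
    rw [sum_subtype_eq_sum (f := fun x => Real.negMulLog ((p ∘ σ.symm) x))
        fun x hx => by simp only [hpz x hx, Real.negMulLog_zero],
      sum_subtype_eq_sum (f := fun x => Real.negMulLog (q x))
        fun x hx => by simp only [hqz x hx, Real.negMulLog_zero]]
    refine lt_of_eq_of_lt ?_ h
    exact Equiv.sum_comp σ.symm fun x => Real.negMulLog (p x)
  obtain ⟨M, P, w, hw0, hw1, hw⟩ := exists_mixture_meanMarginal_eq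
    (p := fun x : { x // q x ≠ 0 } => (p ∘ σ.symm) x) (q := fun x : { x // q x ≠ 0 } => q x)
    (fun x => hp0 _) hp1 (fun x => lt_of_le_of_ne (hq0 x) (Ne.symm x.2)) hq1 hS
  exact CatalyticallyConvertible.of_mixture (fun x => hp0 _) hp1 P hw0 hw1 hw

end Supports

section Matrices

lemma IsDensityMatrix.exists_diagonalization {ι : Type*} [Fintype ι] [DecidableEq ι]
    {ρ : Matrix ι ι ℂ} (h : IsDensityMatrix ρ) :
    (∀ i, 0 ≤ eigs ρ i) ∧ ∑ i, eigs ρ i = 1 ∧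
      ρ.rank = Fintype.card { i // eigs ρ i ≠ 0 } ∧
      ∃ V ∈ Matrix.unitaryGroup ι ℂ, ρ = V * diagonal (fun i => (eigs ρ i : ℂ)) * Vᴴ := by
  have hH : ρ.IsHermitian := h.1.1
  have he : eigs ρ = hH.eigenvalues := dif_pos hH
  rw [he]
  refine ⟨h.1.eigenvalues_nonneg, ?_, hH.rank_eq_card_non_zero_eigs,
    hH.eigenvectorUnitary, hH.eigenvectorUnitary.2, ?_⟩
  · have h1 := hH.trace_eq_sum_eigenvalues
    rw [h.2] at h1
    refine Complex.ofReal_injective ?_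
    rw [Complex.ofReal_sum, Complex.ofReal_one]
    exact h1.symm
  · conv_lhs => rw [hH.spectral_theorem]
    rfl

variable {ι κ : Type*} [Fintype ι] [Fintype κ] [DecidableEq ι] [DecidableEq κ]

lemma permMatrix_mul_diagonal_mul (π : Equiv.Perm ι) (d : ι → ℂ) :
    π.permMatrix ℂ * diagonal d * (π.permMatrix ℂ)ᴴ = diagonal (d ∘ π) := by
  ext i j
  by_cases h : i = j
  · subst h
    simp [Matrix.mul_apply, Equiv.Perm.permMatrix, Equiv.toPEquiv_apply, PEquiv.toMatrix_apply,
      diagonal_apply, Equiv.symm_apply_eq]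
  · simp [Matrix.mul_apply, Equiv.Perm.permMatrix, Equiv.toPEquiv_apply, PEquiv.toMatrix_apply,
      diagonal_apply, Equiv.symm_apply_eq, h]

lemma permMatrix_mem_unitaryGroup (π : Equiv.Perm ι) :
    π.permMatrix ℂ ∈ Matrix.unitaryGroup ι ℂ := by
  rw [Matrix.mem_unitaryGroup_iff, star_eq_conjTranspose]
  simpa [Function.comp_def] using permMatrix_mul_diagonal_mul π fun _ => 1

lemma kronecker_one_mul_diagonal_mul_apply (V : Matrix ι ι ℂ) (d : ι × κ → ℂ) (i j : ι) (k l : κ) :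
    ((V ⊗ₖ (1 : Matrix κ κ ℂ)) * diagonal d * (V ⊗ₖ (1 : Matrix κ κ ℂ))ᴴ) (i, k) (j, l) =
      if k = l then ∑ a, V i a * d (a, k) * star (V j a) else 0 := by
  rw [Matrix.mul_apply, Fintype.sum_prod_type]
  by_cases h : k = l
  · subst h
    simp [Matrix.mul_diagonal, Matrix.one_apply]
  · simp [Matrix.mul_diagonal, Matrix.one_apply, h, Ne.symm h]

lemma ptrace2_kronecker_one_mul_diagonal_mul (V : Matrix ι ι ℂ) (d : ι × κ → ℂ) :
    ptrace2 ((V ⊗ₖ (1 : Matrix κ κ ℂ)) * diagonal d * (V ⊗ₖ (1 : Matrix κ κ ℂ))ᴴ) =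
      V * diagonal (fun a => ∑ k, d (a, k)) * Vᴴ := by
  ext i j
  simp only [ptrace2, Matrix.of_apply, kronecker_one_mul_diagonal_mul_apply, if_true]
  rw [Finset.sum_comm, Matrix.mul_apply]
  refine Finset.sum_congr rfl fun a _ => ?_
  rw [Matrix.mul_diagonal, Matrix.conjTranspose_apply, Finset.mul_sum, Finset.sum_mul]

lemma ptrace1_kronecker_one_mul_diagonal_mul {V : Matrix ι ι ℂ}
    (hV : V ∈ Matrix.unitaryGroup ι ℂ) (d : ι × κ → ℂ) :
    ptrace1 ((V ⊗ₖ (1 : Matrix κ κ ℂ)) * diagonal d * (V ⊗ₖ (1 : Matrix κ κ ℂ))ᴴ) =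
      diagonal fun k => ∑ a, d (a, k) := by
  have hcol : ∀ a, ∑ i, star (V i a) * V i a = 1 := fun a => by
    have := congrFun (congrFun (Matrix.mem_unitaryGroup_iff'.1 hV) a) a
    simpa [Matrix.mul_apply, Matrix.star_apply] using this
  ext k l
  simp only [ptrace1, Matrix.of_apply, kronecker_one_mul_diagonal_mul_apply, diagonal_apply]
  split_ifs
  · rw [Finset.sum_comm]
    refine Finset.sum_congr rfl fun a _ => ?_
    conv_rhs => rw [← one_mul (d (a, k)), ← hcol a, Finset.sum_mul]
    exact Finset.sum_congr rfl fun i _ => by ring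
  · simp

lemma kronecker_one_mem_unitaryGroup {V : Matrix ι ι ℂ} (hV : V ∈ Matrix.unitaryGroup ι ℂ) :
    V ⊗ₖ (1 : Matrix κ κ ℂ) ∈ Matrix.unitaryGroup (ι × κ) ℂ :=
  Matrix.kronecker_mem_unitary hV (one_mem _)

end Matrices

/-- If `S(ρ') > S(ρ)` and `rank ρ' ≥ rank ρ` (for density matrices with
different spectra), then there is a finite-dimensional quasi-classical catalyst `σ` and a
unitary `U` with `tr₂[U(ρ ⊗ σ)U†] = ρ'` and `D[tr₁[U(ρ ⊗ σ)U†]] = σ`. -/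
theorem stmt0 {n : ℕ} (ρ ρ' : Matrix (Fin n) (Fin n) ℂ)
    (hρ : IsDensityMatrix ρ) (hρ' : IsDensityMatrix ρ')
    (hspec : spectra ρ ≠ spectra ρ')
    (hS : vN ρ < vN ρ') (hrank : ρ.rank ≤ ρ'.rank) :
    ∃ (m : ℕ) (σ : Matrix (Fin m) (Fin m) ℂ),
      IsDensityMatrix σ ∧ deph σ = σ ∧
      ∃ U ∈ Matrix.unitaryGroup (Fin n × Fin m) ℂ,
        ptrace2 (U * (ρ ⊗ₖ σ) * Uᴴ) = ρ' ∧
        deph (ptrace1 (U * (ρ ⊗ₖ σ) * Uᴴ)) = σ := by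
  obtain ⟨hp0, hp1, hpr, V, hV, hρV⟩ := hρ.exists_diagonalization
  obtain ⟨hq0, hq1, hqr, W, hW, hρW⟩ := hρ'.exists_diagonalization
  rw [hpr, hqr] at hrank
  obtain ⟨m, c, hc0, hc1, π, hπq, hπc⟩ :=
    CatalyticallyConvertible.of_shannon_lt hp0 hp1 hq0 hq1 hS hrank
  let σ : Matrix (Fin m) (Fin m) ℂ := diagonal fun j => (c j : ℂ)
  let d : Fin n × Fin m → ℂ := fun t => (eigs ρ t.1 : ℂ) * c t.2
  let V₁ := V ⊗ₖ (1 : Matrix (Fin m) (Fin m) ℂ)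
  let W₁ := W ⊗ₖ (1 : Matrix (Fin m) (Fin m) ℂ)
  have hV₁ : V₁ ∈ Matrix.unitaryGroup (Fin n × Fin m) ℂ := kronecker_one_mem_unitaryGroup hV
  have hW₁ : W₁ ∈ Matrix.unitaryGroup (Fin n × Fin m) ℂ := kronecker_one_mem_unitaryGroup hW
  have hdiag : ρ ⊗ₖ σ = V₁ * diagonal d * V₁ᴴ := by
    conv_lhs => rw [hρV, ← one_mul σ, ← mul_one (1 * σ)]
    rw [Matrix.mul_kronecker_mul, Matrix.mul_kronecker_mul, diagonal_kronecker_diagonal,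
      conjTranspose_kronecker, conjTranspose_one]
  have hV₁' : V₁ᴴ * V₁ = 1 := Matrix.mem_unitaryGroup_iff'.1 hV₁
  have hconj : (W₁ * π.permMatrix ℂ * V₁ᴴ) * (ρ ⊗ₖ σ) * (W₁ * π.permMatrix ℂ * V₁ᴴ)ᴴ =
      W₁ * diagonal (d ∘ π) * W₁ᴴ := by
    rw [hdiag, ← permMatrix_mul_diagonal_mul]
    simp only [conjTranspose_mul, conjTranspose_conjTranspose]
    calc _ = W₁ * π.permMatrix ℂ * (V₁ᴴ * V₁) * diagonal d * (V₁ᴴ * V₁) *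
          (π.permMatrix ℂ)ᴴ * W₁ᴴ := by simp only [Matrix.mul_assoc]
      _ = _ := by simp only [hV₁', Matrix.mul_one, Matrix.mul_assoc]
  refine ⟨m, σ, ⟨?_, ?_⟩, ?_, W₁ * π.permMatrix ℂ * V₁ᴴ,
    mul_mem (mul_mem hW₁ (permMatrix_mem_unitaryGroup π)) (Unitary.star_mem hV₁), ?_, ?_⟩
  · exact Matrix.PosSemidef.diagonal fun j => Complex.zero_le_real.2 (hc0 j)
  · rw [trace_diagonal]
    exact_mod_cast hc1
  · simp [deph, σ]
  · rw [hconj, ptrace2_kronecker_one_mul_diagonal_mul]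
    conv_rhs => rw [hρW]
    congr 3
    funext a
    simp only [Function.comp_apply, d, ← hπq a]
    push_cast
    rfl
  · rw [hconj, ptrace1_kronecker_one_mul_diagonal_mul hW]
    simp only [deph, σ, diagonal_apply_eq]
    congr 1
    funext j
    simp only [Function.comp_apply, d]
    exact_mod_cast hπc j
end
end

section
/- Let ρ and ρ' be density matrices of the same finite dimension. Suppose there exists a finite-dimensional density matrix σ, a finite dimension d, and a unitary U on the joint space such that tr_C[U(ρ ⊗ 𝟙_d ⊗ σ)U†] = ρ' ⊗ 𝟙_d and tr_{A,R}[U(ρ ⊗ 𝟙_d ⊗ σ)U†] = σ, where 𝟙_d is the maximally mixed state of dimension d, tr_C traces out the catalyst factor and tr_{A,R} traces out the system and ancilla factors. Then S(ρ') ≥ S(ρ) and rank(ρ') ≥ rank(ρ). -/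
open scoped Kronecker ComplexOrder
open Matrix

noncomputable section

lemma mul_sub_mul_le_mul_log {t a s b c : ℝ} (ht : 0 ≤ t) (ha : 0 ≤ a) (hs : 0 ≤ s)
    (hb : 0 ≤ b) (hc : 0 ≤ c) (h : b * c = 0 → t * (a * s) = 0) :
    t * (a * s) - t * (b * c) ≤
      t * (a * s) * (Real.log a + Real.log s - Real.log b - Real.log c) := by
  by_cases h0 : t * (a * s) = 0
  · rw [h0, zero_mul]
    have : 0 ≤ t * (b * c) := by positivity
    linarith
  · have hbc : b * c ≠ 0 := fun hz => h0 (h hz)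
    have ha0 : a ≠ 0 := by rintro rfl; simp at h0
    have hs0 : s ≠ 0 := by rintro rfl; simp at h0
    have hb0 : b ≠ 0 := left_ne_zero_of_mul hbc
    have hc0 : c ≠ 0 := right_ne_zero_of_mul hbc
    have hlog : Real.log (b * c / (a * s)) =
        Real.log b + Real.log c - (Real.log a + Real.log s) := by
      rw [Real.log_div hbc (mul_ne_zero ha0 hs0), Real.log_mul hb0 hc0, Real.log_mul ha0 hs0]
    have hle : Real.log (b * c / (a * s)) ≤ b * c / (a * s) - 1 :=
      Real.log_le_sub_one_of_pos (by positivity)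
    have hmul := mul_le_mul_of_nonneg_left hle (show 0 ≤ t * (a * s) by positivity)
    have hcancel : t * (a * s) * (b * c / (a * s) - 1) = t * (b * c) - t * (a * s) := by
      field_simp
    rw [hcancel, hlog] at hmul
    linarith

section Classical

variable {ι κ : Type*} [Fintype ι] [Fintype κ] {T : ι × κ → ι × κ → ℝ} {α β : ι → ℝ} {s : κ → ℝ}

/-- A bistochastic map `T` only sends mass to the product of the supports of the marginals of its
output. -/
lemma mul_eq_zero_of_marginals (hT : ∀ x y, 0 ≤ T x y) (hα : ∀ i, 0 ≤ α i) (hs : ∀ k, 0 ≤ s k)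
    (hA : ∀ i, ∑ k, ∑ y, T (i, k) y * (α y.1 * s y.2) = β i)
    (hB : ∀ k, ∑ i, ∑ y, T (i, k) y * (α y.1 * s y.2) = s k)
    (x y : ι × κ) (h : β x.1 * s x.2 = 0) : T x y * (α y.1 * s y.2) = 0 := by
  have hn : ∀ x y, 0 ≤ T x y * (α y.1 * s y.2) := fun x y =>
    mul_nonneg (hT x y) (mul_nonneg (hα _) (hs _))
  obtain ⟨i, k⟩ := x
  have hsum : ∑ y, T (i, k) y * (α y.1 * s y.2) = 0 := by
    rcases mul_eq_zero.1 h with h | h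
    · have h' := (hA i).trans h
      exact (Finset.sum_eq_zero_iff_of_nonneg
        fun k _ => Finset.sum_nonneg fun y _ => hn (i, k) y).1 h' k (Finset.mem_univ _)
    · have h' := (hB k).trans h
      exact (Finset.sum_eq_zero_iff_of_nonneg
        fun i _ => Finset.sum_nonneg fun y _ => hn (i, k) y).1 h' i (Finset.mem_univ _)
  exact (Finset.sum_eq_zero_iff_of_nonneg fun y _ => hn (i, k) y).1 hsum y (Finset.mem_univ _)

/-- If a bistochastic matrix sends `α ⊗ s` to a distribution with marginals `β` and `s`, then the
Shannon entropy of `β` is at least that of `α`. -/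
lemma sum_negMulLog_le_of_bistochastic (hT : ∀ x y, 0 ≤ T x y) (hr : ∀ x, ∑ y, T x y = 1)
    (hc : ∀ y, ∑ x, T x y = 1) (hα : ∀ i, 0 ≤ α i) (hβ : ∀ i, 0 ≤ β i) (hs : ∀ k, 0 ≤ s k)
    (hα1 : ∑ i, α i = 1) (hβ1 : ∑ i, β i = 1) (hs1 : ∑ k, s k = 1)
    (hA : ∀ i, ∑ k, ∑ y, T (i, k) y * (α y.1 * s y.2) = β i)
    (hB : ∀ k, ∑ i, ∑ y, T (i, k) y * (α y.1 * s y.2) = s k) :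
    ∑ i, Real.negMulLog (α i) ≤ ∑ i, Real.negMulLog (β i) := by
  have hcol : ∀ f : ι × κ → ℝ, ∑ x, ∑ y, T x y * f y = ∑ y, f y := fun f => by
    rw [Finset.sum_comm]
    simp_rw [← Finset.sum_mul, hc, one_mul]
  have hrow : ∀ f : ι × κ → ℝ, ∑ x, ∑ y, T x y * f x = ∑ x, f x := fun f => by
    simp_rw [← Finset.sum_mul, hr, one_mul]
  have hkey : ∑ x, ∑ y, (T x y * (α y.1 * s y.2) - T x y * (β x.1 * s x.2)) ≤
      ∑ x, ∑ y, T x y * (α y.1 * s y.2) *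
        (Real.log (α y.1) + Real.log (s y.2) - Real.log (β x.1) - Real.log (s x.2)) :=
    Finset.sum_le_sum fun x _ => Finset.sum_le_sum fun y _ =>
      mul_sub_mul_le_mul_log (hT x y) (hα _) (hs _) (hβ _) (hs _)
        (mul_eq_zero_of_marginals hT hα hs hA hB x y)
  have hprod : ∀ (f : ι → ℝ) (g : κ → ℝ), ∑ y : ι × κ, f y.1 * g y.2 = (∑ i, f i) * ∑ k, g k :=
    fun f g => by rw [Fintype.sum_prod_type, Finset.sum_mul_sum]
  have e1 : ∑ x, ∑ y, T x y * (α y.1 * s y.2) * Real.log (α y.1) =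
      ∑ i, α i * Real.log (α i) := by
    simp_rw [mul_assoc (T _ _)]
    rw [hcol fun y => α y.1 * s y.2 * Real.log (α y.1)]
    rw [Finset.sum_congr rfl fun y _ => mul_right_comm (α y.1) (s y.2) (Real.log (α y.1)),
      hprod (fun i => α i * Real.log (α i)) s, hs1, mul_one]
  have e2 : ∑ x, ∑ y, T x y * (α y.1 * s y.2) * Real.log (s y.2) =
      ∑ k, s k * Real.log (s k) := by
    simp_rw [mul_assoc (T _ _)]
    rw [hcol fun y => α y.1 * s y.2 * Real.log (s y.2)]
    simp_rw [mul_assoc (α _)]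
    rw [hprod α fun k => s k * Real.log (s k), hα1, one_mul]
  have e3 : ∑ x, ∑ y, T x y * (α y.1 * s y.2) * Real.log (β x.1) =
      ∑ i, β i * Real.log (β i) := by
    rw [Fintype.sum_prod_type]
    simp_rw [← Finset.sum_mul, hA]
  have e4 : ∑ x, ∑ y, T x y * (α y.1 * s y.2) * Real.log (s x.2) =
      ∑ k, s k * Real.log (s k) := by
    rw [Fintype.sum_prod_type_right]
    simp_rw [← Finset.sum_mul, hB]
  simp_rw [mul_sub, mul_add, Finset.sum_sub_distrib, Finset.sum_add_distrib] at hkey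
  rw [e1, e2, e3, e4, hcol fun y => α y.1 * s y.2, hrow fun x => β x.1 * s x.2,
    hprod, hprod, hα1, hβ1] at hkey
  simp only [Real.negMulLog, neg_mul, Finset.sum_neg_distrib]
  linarith

/-- If a bistochastic matrix sends `α ⊗ s` to a distribution with marginals `β` and `s`, then the
support of `β` is at least as large as that of `α`. -/
lemma card_support_le_of_bistochastic [DecidableEq ι] [DecidableEq κ]
    (hT : ∀ x y, 0 ≤ T x y) (hr : ∀ x, ∑ y, T x y = 1)
    (hc : ∀ y, ∑ x, T x y = 1) (hα : ∀ i, 0 ≤ α i) (hs : ∀ k, 0 ≤ s k) (hs1 : ∑ k, s k = 1)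
    (hA : ∀ i, ∑ k, ∑ y, T (i, k) y * (α y.1 * s y.2) = β i)
    (hB : ∀ k, ∑ i, ∑ y, T (i, k) y * (α y.1 * s y.2) = s k) :
    Fintype.card {i // α i ≠ 0} ≤ Fintype.card {i // β i ≠ 0} := by
  rw [Fintype.card_subtype, Fintype.card_subtype]
  set S := Finset.univ.filter fun k => s k ≠ 0
  set P := Finset.univ.filter fun i => α i ≠ 0
  set R := Finset.univ.filter fun i => β i ≠ 0
  have hS : 0 < S.card := by
    rw [Finset.card_pos]
    by_contra hne
    have h0 : ∀ k, s k = 0 := by simpa [S, Finset.filter_eq_empty_iff] using hne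
    simp [h0] at hs1
  have hcol : ∀ y ∈ P ×ˢ S, ∑ x ∈ R ×ˢ S, T x y = 1 := fun y hy => by
    rw [← hc y]
    refine Finset.sum_subset (Finset.subset_univ _) fun x _ hx => ?_
    have h0 : β x.1 * s x.2 = 0 := by
      by_contra hne
      exact hx (by simpa [R, S] using hne)
    have hy' : α y.1 * s y.2 ≠ 0 := by simpa [P, S] using hy
    exact (mul_eq_zero.1 (mul_eq_zero_of_marginals hT hα hs hA hB x y h0)).resolve_right hy'
  have hle : ((P ×ˢ S).card : ℝ) ≤ (R ×ˢ S).card := by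
    calc ((P ×ˢ S).card : ℝ) = ∑ y ∈ P ×ˢ S, ∑ x ∈ R ×ˢ S, T x y := by
          rw [Finset.sum_congr rfl hcol]; simp
      _ = ∑ x ∈ R ×ˢ S, ∑ y ∈ P ×ˢ S, T x y := Finset.sum_comm
      _ ≤ ∑ x ∈ R ×ˢ S, ∑ y, T x y := Finset.sum_le_sum fun x _ =>
          Finset.sum_le_sum_of_subset_of_nonneg (Finset.subset_univ _) fun y _ _ => hT x y
      _ = (R ×ˢ S).card := by simp [hr]
  rw [Nat.cast_le, Finset.card_product, Finset.card_product] at hle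
  exact Nat.le_of_mul_le_mul_right hle hS

end Classical

section PartialTrace

variable {ι κ : Type*} [Fintype ι] [Fintype κ]

lemma ptrace2_kronecker_conj [DecidableEq κ] (A A' : Matrix ι ι ℂ) (B B' : Matrix κ κ ℂ) (hB : B' * B = 1)
    (M : Matrix (ι × κ) (ι × κ) ℂ) :
    ptrace2 ((A ⊗ₖ B) * M * (A' ⊗ₖ B')) = A * ptrace2 M * A' := by
  have hB' : ∀ l k, ∑ c, B' l c * B c k = if l = k then 1 else 0 := fun l k => by
    rw [← Matrix.mul_apply, hB, Matrix.one_apply]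
  ext i j
  simp only [ptrace2, Matrix.of_apply, Matrix.mul_apply, Matrix.kroneckerMap_apply,
    Fintype.sum_prod_type, Finset.sum_mul, Finset.mul_sum]
  calc ∑ c, ∑ j', ∑ l, ∑ i', ∑ k, A i i' * B c k * M (i', k) (j', l) * (A' j' j * B' l c)
      = ∑ j', ∑ l, ∑ i', ∑ k, ∑ c,
          A i i' * B c k * M (i', k) (j', l) * (A' j' j * B' l c) := by
        rw [Finset.sum_comm]
        refine Finset.sum_congr rfl fun j' _ => ?_
        rw [Finset.sum_comm]
        refine Finset.sum_congr rfl fun l _ => ?_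
        rw [Finset.sum_comm]
        refine Finset.sum_congr rfl fun i' _ => ?_
        rw [Finset.sum_comm]
    _ = ∑ j', ∑ l, ∑ i', ∑ k,
          A i i' * M (i', k) (j', l) * A' j' j * ∑ c, B' l c * B c k := by
        simp_rw [Finset.mul_sum]
        refine Finset.sum_congr rfl fun j' _ => Finset.sum_congr rfl fun l _ =>
          Finset.sum_congr rfl fun i' _ => Finset.sum_congr rfl fun k _ =>
          Finset.sum_congr rfl fun c _ => by ring
    _ = ∑ j', ∑ i', ∑ k, A i i' * M (i', k) (j', k) * A' j' j := by
        refine Finset.sum_congr rfl fun j' _ => ?_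
        rw [Finset.sum_comm]
        simp [hB']

lemma ptrace1_kronecker_conj [DecidableEq ι] (A A' : Matrix ι ι ℂ) (B B' : Matrix κ κ ℂ) (hA : A' * A = 1)
    (M : Matrix (ι × κ) (ι × κ) ℂ) :
    ptrace1 ((A ⊗ₖ B) * M * (A' ⊗ₖ B')) = B * ptrace1 M * B' := by
  have hswap : ∀ (C : Matrix ι ι ℂ) (D : Matrix κ κ ℂ),
      (C ⊗ₖ D).submatrix Prod.swap Prod.swap = D ⊗ₖ C := fun C D => by
    ext x y
    simp [mul_comm]
  have hptrace : ∀ N : Matrix (ι × κ) (ι × κ) ℂ,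
      ptrace1 N = ptrace2 (N.submatrix Prod.swap Prod.swap) := fun N => rfl
  rw [hptrace, hptrace, ← ptrace2_kronecker_conj B B' A A' hA,
    ← hswap, ← hswap]
  congr 1
  have h := fun X Y : Matrix (ι × κ) (ι × κ) ℂ =>
    Matrix.submatrix_mul_equiv X Y Prod.swap (Equiv.prodComm κ ι) Prod.swap
  simp only [Equiv.coe_prodComm] at h
  rw [h, h]

end PartialTrace

lemma exists_unitary_diagonal_eigs {ι : Type*} [Fintype ι] [DecidableEq ι] {ρ : Matrix ι ι ℂ}
    (hρ : ρ.IsHermitian) : ∃ V : Matrix ι ι ℂ, V * Vᴴ = 1 ∧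
      ρ = V * Matrix.diagonal (fun i => (eigs ρ i : ℂ)) * Vᴴ := by
  refine ⟨hρ.eigenvectorUnitary, ?_, ?_⟩
  · exact Matrix.mem_unitaryGroup_iff.1 hρ.eigenvectorUnitary.2
  · have h := hρ.spectral_theorem
    rw [Unitary.conjStarAlgAut_apply] at h
    simp only [eigs, dif_pos hρ]
    exact h

namespace IsDensityMatrix

variable {ι : Type*} [Fintype ι] [DecidableEq ι] {ρ : Matrix ι ι ℂ}

lemma eigs_nonneg (hρ : IsDensityMatrix ρ) (i : ι) : 0 ≤ eigs ρ i := by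
  rw [eigs, dif_pos hρ.1.isHermitian]
  exact hρ.1.eigenvalues_nonneg i

lemma sum_eigs (hρ : IsDensityMatrix ρ) : ∑ i, eigs ρ i = 1 := by
  have h := hρ.1.isHermitian.trace_eq_sum_eigenvalues
  simp only [eigs, dif_pos hρ.1.isHermitian]
  refine Complex.ofReal_injective ?_
  push_cast
  exact h.symm.trans hρ.2

lemma rank_eq_card (hρ : IsDensityMatrix ρ) : ρ.rank = Fintype.card {i // eigs ρ i ≠ 0} := by
  rw [hρ.1.isHermitian.rank_eq_card_non_zero_eigs]
  simp only [eigs, dif_pos hρ.1.isHermitian]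

end IsDensityMatrix

/-- The diagonal of a unitary conjugate of a diagonal matrix. -/
lemma conj_diagonal_apply_self {ι : Type*} [Fintype ι] [DecidableEq ι] (Q : Matrix ι ι ℂ)
    (v : ι → ℝ) (x : ι) :
    (Q * Matrix.diagonal (fun i => (v i : ℂ)) * Qᴴ) x x =
      ((∑ y, Complex.normSq (Q x y) * v y : ℝ) : ℂ) := by
  rw [Matrix.mul_apply]
  push_cast
  refine Finset.sum_congr rfl fun y _ => ?_
  rw [Matrix.mul_diagonal, Matrix.conjTranspose_apply, Complex.star_def, mul_right_comm,
    Complex.mul_conj]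

lemma sum_normSq_row {ι : Type*} [Fintype ι] [DecidableEq ι] {Q : Matrix ι ι ℂ}
    (hQ : Q * Qᴴ = 1) (x : ι) : ∑ y, Complex.normSq (Q x y) = 1 := by
  have h := conj_diagonal_apply_self Q (fun _ => 1) x
  simp only [Complex.ofReal_one, Matrix.diagonal_one, mul_one, hQ, Matrix.one_apply_eq] at h
  exact_mod_cast h.symm

lemma sum_normSq_col {ι : Type*} [Fintype ι] [DecidableEq ι] {Q : Matrix ι ι ℂ}
    (hQ : Qᴴ * Q = 1) (y : ι) : ∑ x, Complex.normSq (Q x y) = 1 := by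
  have h := sum_normSq_row (Q := Qᴴ) (by rwa [Matrix.conjTranspose_conjTranspose]) y
  simpa [Matrix.conjTranspose_apply, Complex.normSq_conj] using h

lemma diagonal_kronecker_mm {ι : Type*} [DecidableEq ι] {d : ℕ} (r : ι → ℝ) :
    Matrix.diagonal (fun i => (r i : ℂ)) ⊗ₖ mm d =
      Matrix.diagonal fun x : ι × Fin d => ((r x.1 / d : ℝ) : ℂ) := by
  have : mm d = Matrix.diagonal fun _ => (d : ℂ)⁻¹ := by
    rw [mm, Matrix.smul_one_eq_diagonal]
  rw [this, Matrix.diagonal_kronecker_diagonal]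
  congr 1
  ext x
  push_cast
  rw [div_eq_mul_inv]

section MaximallyMixed

variable {ι : Type*} [Fintype ι] {d : ℕ}

lemma sum_div_mixed (hd : 0 < d) (r : ι → ℝ) : ∑ x : ι × Fin d, r x.1 / d = ∑ i, r i := by
  have hd' : (d : ℝ) ≠ 0 := by positivity
  rw [Fintype.sum_prod_type]
  refine Finset.sum_congr rfl fun i _ => ?_
  simp
  field_simp

lemma sum_negMulLog_div_mixed (hd : 0 < d) {r : ι → ℝ} (hr : ∑ i, r i = 1) :
    ∑ x : ι × Fin d, Real.negMulLog (r x.1 / d) = ∑ i, Real.negMulLog (r i) + Real.log d := by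
  have hd' : (d : ℝ) ≠ 0 := by positivity
  have h : ∀ i, ∑ _j : Fin d, Real.negMulLog (r i / d) =
      Real.negMulLog (r i) + r i * Real.log d := fun i => by
    rw [div_eq_mul_inv, Real.negMulLog_mul]
    simp [Real.negMulLog, Real.log_inv]
    field_simp
  rw [Fintype.sum_prod_type]
  simp only [h]
  rw [Finset.sum_add_distrib, ← Finset.sum_mul, hr, one_mul]

lemma card_support_div_mixed [DecidableEq ι] (hd : 0 < d) (r : ι → ℝ) :
    Fintype.card {x : ι × Fin d // r x.1 / d ≠ 0} = Fintype.card {i // r i ≠ 0} * d := by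
  have hd' : (d : ℝ) ≠ 0 := by positivity
  rw [Fintype.card_subtype, Fintype.card_subtype]
  have : (Finset.univ.filter fun x : ι × Fin d => r x.1 / d ≠ 0) =
      (Finset.univ.filter fun i => r i ≠ 0) ×ˢ Finset.univ := by
    ext x
    simp [hd.ne']
  rw [this, Finset.card_product]
  simp

/-- A diagonalization of `ρ` yields one of `ρ ⊗ mm d`. -/
lemma kronecker_mm_eq_conj [DecidableEq ι] {ρ V : Matrix ι ι ℂ} {r : ι → ℝ}
    (h : ρ = V * Matrix.diagonal (fun i => (r i : ℂ)) * Vᴴ) :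
    ρ ⊗ₖ mm d = (V ⊗ₖ (1 : Matrix (Fin d) (Fin d) ℂ)) *
      Matrix.diagonal (fun x : ι × Fin d => ((r x.1 / d : ℝ) : ℂ)) *
        (V ⊗ₖ (1 : Matrix (Fin d) (Fin d) ℂ))ᴴ := by
  rw [← diagonal_kronecker_mm, Matrix.conjTranspose_kronecker, ← Matrix.mul_kronecker_mul,
    ← Matrix.mul_kronecker_mul, ← h]
  simp

end MaximallyMixed

lemma conjTranspose_conj_cancel {ι : Type*} [Fintype ι] [DecidableEq ι]
    {X D : Matrix ι ι ℂ} (hX : Xᴴ * X = 1) :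
    Xᴴ * (X * D * Xᴴ) * X = D := by
  rw [← Matrix.mul_assoc, ← Matrix.mul_assoc, hX, Matrix.one_mul, Matrix.mul_assoc, hX,
    Matrix.mul_one]

section Unitary

variable {ι κ : Type*} [Fintype ι] [Fintype κ] [DecidableEq ι] [DecidableEq κ]

lemma kronecker_mul_conjTranspose_eq_one {A : Matrix ι ι ℂ} {B : Matrix κ κ ℂ}
    (hA : A * Aᴴ = 1) (hB : B * Bᴴ = 1) : (A ⊗ₖ B) * (A ⊗ₖ B)ᴴ = 1 := by
  rw [Matrix.conjTranspose_kronecker, ← Matrix.mul_kronecker_mul, hA, hB, Matrix.one_kronecker_one]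

/-- A catalytic transition between states diagonalized by unitaries `P`, `V`, with catalyst
diagonalized by `W`, induces a bistochastic matrix on the eigenvalues. -/
lemma exists_bistochastic {P V : Matrix ι ι ℂ} {W : Matrix κ κ ℂ}
    {U : Matrix (ι × κ) (ι × κ) ℂ} (hP : P * Pᴴ = 1) (hV : V * Vᴴ = 1) (hW : W * Wᴴ = 1)
    (hU : U * Uᴴ = 1) {α β : ι → ℝ} {s : κ → ℝ} {τ τ' : Matrix ι ι ℂ} {σ : Matrix κ κ ℂ}
    (hτ : τ = P * Matrix.diagonal (fun i => (α i : ℂ)) * Pᴴ)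
    (hτ' : τ' = V * Matrix.diagonal (fun i => (β i : ℂ)) * Vᴴ)
    (hσ : σ = W * Matrix.diagonal (fun i => (s i : ℂ)) * Wᴴ)
    (h1 : ptrace2 (U * (τ ⊗ₖ σ) * Uᴴ) = τ') (h2 : ptrace1 (U * (τ ⊗ₖ σ) * Uᴴ) = σ) :
    ∃ T : ι × κ → ι × κ → ℝ, (∀ x y, 0 ≤ T x y) ∧ (∀ x, ∑ y, T x y = 1) ∧
      (∀ y, ∑ x, T x y = 1) ∧
      (∀ i, ∑ k, ∑ y, T (i, k) y * (α y.1 * s y.2) = β i) ∧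
      (∀ k, ∑ i, ∑ y, T (i, k) y * (α y.1 * s y.2) = s k) := by
  have hV' : Vᴴ * V = 1 := mul_eq_one_comm.1 hV
  have hW' : Wᴴ * W = 1 := mul_eq_one_comm.1 hW
  set Q : Matrix (ι × κ) (ι × κ) ℂ := (Vᴴ ⊗ₖ Wᴴ) * U * (P ⊗ₖ W) with hQdef
  have hQ : Q * Qᴴ = 1 := by
    have hPW := kronecker_mul_conjTranspose_eq_one hP hW
    have hVW := kronecker_mul_conjTranspose_eq_one (A := Vᴴ) (B := Wᴴ)
      (by rwa [Matrix.conjTranspose_conjTranspose]) (by rwa [Matrix.conjTranspose_conjTranspose])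
    calc Q * Qᴴ = (Vᴴ ⊗ₖ Wᴴ) * (U * ((P ⊗ₖ W) * (P ⊗ₖ W)ᴴ) * Uᴴ) * (Vᴴ ⊗ₖ Wᴴ)ᴴ := by
          rw [hQdef]
          simp only [Matrix.conjTranspose_mul, Matrix.mul_assoc]
      _ = 1 := by rw [hPW, Matrix.mul_one, hU, Matrix.mul_one, hVW]
  have hQ' : Qᴴ * Q = 1 := mul_eq_one_comm.1 hQ
  have hN : Q * Matrix.diagonal (fun y : ι × κ => ((α y.1 * s y.2 : ℝ) : ℂ)) * Qᴴ =
      (Vᴴ ⊗ₖ Wᴴ) * (U * (τ ⊗ₖ σ) * Uᴴ) * (V ⊗ₖ W) := by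
    have hD : Matrix.diagonal (fun y : ι × κ => ((α y.1 * s y.2 : ℝ) : ℂ)) =
        Matrix.diagonal (fun i => (α i : ℂ)) ⊗ₖ Matrix.diagonal (fun i => (s i : ℂ)) := by
      rw [Matrix.diagonal_kronecker_diagonal]
      push_cast
      rfl
    rw [hτ, hσ, hD, Matrix.mul_kronecker_mul, Matrix.mul_kronecker_mul, hQdef]
    simp only [Matrix.conjTranspose_mul, Matrix.conjTranspose_kronecker,
      Matrix.conjTranspose_conjTranspose, Matrix.mul_assoc]
  have m2 := ptrace2_kronecker_conj Vᴴ V Wᴴ W hW (U * (τ ⊗ₖ σ) * Uᴴ)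
  have m1 := ptrace1_kronecker_conj Vᴴ V Wᴴ W hV (U * (τ ⊗ₖ σ) * Uᴴ)
  rw [h1, ← hN, hτ', conjTranspose_conj_cancel hV'] at m2
  rw [h2, ← hN] at m1
  nth_rw 1 [hσ] at m1
  rw [conjTranspose_conj_cancel hW'] at m1
  refine ⟨fun x y => Complex.normSq (Q x y), fun x y => Complex.normSq_nonneg _,
    sum_normSq_row hQ, sum_normSq_col hQ', fun i => ?_, fun k => ?_⟩
  · have h := congrFun (congrFun m2 i) i
    simp only [ptrace2, Matrix.of_apply, Matrix.diagonal_apply_eq, conj_diagonal_apply_self] at h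
    exact_mod_cast h
  · have h := congrFun (congrFun m1 k) k
    simp only [ptrace1, Matrix.of_apply, Matrix.diagonal_apply_eq, conj_diagonal_apply_self] at h
    exact_mod_cast h

end Unitary

/-- weak solution, converse direction. If `ρ → ρ'` is possible with a
maximally mixed ancilla `𝟙_d` that is returned in product with `ρ'`, and a catalyst `σ`
that is returned exactly, then `S(ρ') ≥ S(ρ)` and `rank ρ' ≥ rank ρ`. -/
theorem stmt3 {n : ℕ} (ρ ρ' : Matrix (Fin n) (Fin n) ℂ)
    (hρ : IsDensityMatrix ρ) (hρ' : IsDensityMatrix ρ')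
    {d m : ℕ} (hd : 0 < d)
    (σ : Matrix (Fin m) (Fin m) ℂ) (hσ : IsDensityMatrix σ)
    (U : Matrix ((Fin n × Fin d) × Fin m) ((Fin n × Fin d) × Fin m) ℂ)
    (hU : U ∈ Matrix.unitaryGroup ((Fin n × Fin d) × Fin m) ℂ)
    (h1 : ptrace2 (U * ((ρ ⊗ₖ mm d) ⊗ₖ σ) * Uᴴ) = ρ' ⊗ₖ mm d)
    (h2 : ptrace1 (U * ((ρ ⊗ₖ mm d) ⊗ₖ σ) * Uᴴ) = σ) :
    vN ρ ≤ vN ρ' ∧ ρ.rank ≤ ρ'.rank := by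
  obtain ⟨P, hP, hρP⟩ := exists_unitary_diagonal_eigs hρ.1.isHermitian
  obtain ⟨V, hV, hρV⟩ := exists_unitary_diagonal_eigs hρ'.1.isHermitian
  obtain ⟨W, hW, hσW⟩ := exists_unitary_diagonal_eigs hσ.1.isHermitian
  have hone : (1 : Matrix (Fin d) (Fin d) ℂ) * (1 : Matrix (Fin d) (Fin d) ℂ)ᴴ = 1 := by simp
  obtain ⟨T, hT, hr, hc, hA, hB⟩ := exists_bistochastic
    (kronecker_mul_conjTranspose_eq_one hP hone) (kronecker_mul_conjTranspose_eq_one hV hone) hW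
    (Matrix.mem_unitaryGroup_iff.1 hU) (kronecker_mm_eq_conj hρP) (kronecker_mm_eq_conj hρV)
    hσW h1 h2
  have hα : ∀ x : Fin n × Fin d, 0 ≤ eigs ρ x.1 / d := fun x =>
    div_nonneg (hρ.eigs_nonneg _) d.cast_nonneg
  have hβ : ∀ x : Fin n × Fin d, 0 ≤ eigs ρ' x.1 / d := fun x =>
    div_nonneg (hρ'.eigs_nonneg _) d.cast_nonneg
  constructor
  · have h := sum_negMulLog_le_of_bistochastic hT hr hc hα hβ hσ.eigs_nonneg
      ((sum_div_mixed hd _).trans hρ.sum_eigs) ((sum_div_mixed hd _).trans hρ'.sum_eigs)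
      hσ.sum_eigs hA hB
    rw [sum_negMulLog_div_mixed hd hρ.sum_eigs, sum_negMulLog_div_mixed hd hρ'.sum_eigs] at h
    exact le_of_add_le_add_right h
  · have h := card_support_le_of_bistochastic hT hr hc hα hσ.eigs_nonneg hσ.sum_eigs hA hB
    rw [card_support_div_mixed hd, card_support_div_mixed hd] at h
    rw [hρ.rank_eq_card, hρ'.rank_eq_card]
    exact Nat.le_of_mul_le_mul_right h hd
end
end
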